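/- arXiv:1712.00696 — 7 statements merged into one kernel-verified Lean document; each statement's English description precedes it below -/
import Mathlib

section
/- Let n ≥ 1, L ≥ 0, and let ν be an L-stable n-valuation. Let X and Y be finite metric spaces, let R be a correspondence between X and Y, and let S ⊆ R be a nonempty subset with coordinate projections π₁(S) ⊆ X and π₂(S) ⊆ Y. Then |ν(K_n(π₁(S))) − ν(K_n(π₂(S)))| ≤ L · dis(R). -/
open Set Metric

/-- The `n`-th curvature set of a subset `σ` of a metric space `X`. -/
def curvSet (X : Type) [MetricSpace X] (n : ℕ) (σ : Set X) :
    Set (Fin n → Fin n → ℝ) :=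
  { A | ∃ x : Fin n → X, (∀ i, x i ∈ σ) ∧ A = fun i j => dist (x i) (x j) }

/-- The distortion of a relation `R ⊆ X × Y`. -/
noncomputable def dis {X Y : Type} [MetricSpace X] [MetricSpace Y]
    (R : Set (X × Y)) : ℝ :=
  sSup { t | ∃ p ∈ R, ∃ q ∈ R, t = |dist p.1 q.1 - dist p.2 q.2| }

theorem curvSet_finite (X : Type) [MetricSpace X] [Finite X] (n : ℕ) (σ : Set X) :
    (curvSet X n σ).Finite := by
  refine (Set.finite_range fun (x : Fin n → X) (i j : Fin n) => dist (x i) (x j)).subset ?_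
  rintro A ⟨x, -, rfl⟩
  exact ⟨x, rfl⟩

theorem curvSet_nonempty {X : Type} [MetricSpace X] (n : ℕ) {σ : Set X} (hσ : σ.Nonempty) :
    (curvSet X n σ).Nonempty := by
  obtain ⟨a, ha⟩ := hσ
  exact ⟨_, fun _ => a, fun _ => ha, rfl⟩

theorem abs_dist_sub_dist_le_dis {X Y : Type} [MetricSpace X] [MetricSpace Y] [Finite X] [Finite Y]
    {R : Set (X × Y)} {p q : X × Y} (hp : p ∈ R) (hq : q ∈ R) :
    |dist p.1 q.1 - dist p.2 q.2| ≤ dis R := by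
  refine le_csSup (Set.Finite.bddAbove ?_) ⟨p, hp, q, hq, rfl⟩
  refine (Set.finite_range fun r : (X × Y) × (X × Y) =>
    |dist r.1.1 r.2.1 - dist r.1.2 r.2.2|).subset ?_
  rintro t ⟨p, -, q, -, rfl⟩
  exact ⟨(p, q), rfl⟩

theorem dis_nonneg {X Y : Type} [MetricSpace X] [MetricSpace Y] (R : Set (X × Y)) :
    0 ≤ dis R := by
  refine Real.sSup_nonneg ?_
  rintro t ⟨p, -, q, -, rfl⟩
  exact abs_nonneg _

theorem hausdorffDist_curvSet_le_dis {X Y : Type} [MetricSpace X] [MetricSpace Y]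
    [Finite X] [Finite Y] (n : ℕ) {R S : Set (X × Y)} (hSR : S ⊆ R) :
    hausdorffDist (curvSet X n (Prod.fst '' S)) (curvSet Y n (Prod.snd '' S)) ≤ dis R := by
  have hdist (p : Fin n → X × Y) (hp : ∀ i, p i ∈ S) :
      dist (fun i j => dist (p i).1 (p j).1) (fun i j => dist (p i).2 (p j).2) ≤ dis R := by
    refine (dist_pi_le_iff (dis_nonneg R)).2 fun i => (dist_pi_le_iff (dis_nonneg R)).2 fun j => ?_
    rw [Real.dist_eq]
    exact abs_dist_sub_dist_le_dis (hSR (hp i)) (hSR (hp j))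
  refine hausdorffDist_le_of_mem_dist (dis_nonneg R) ?_ ?_
  · rintro A ⟨x, hx, rfl⟩
    choose p hp hpx using hx
    obtain rfl : (fun i => (p i).1) = x := funext hpx
    exact ⟨_, ⟨fun i => (p i).2, fun i => ⟨p i, hp i, rfl⟩, rfl⟩, hdist p hp⟩
  · rintro A ⟨y, hy, rfl⟩
    choose p hp hpy using hy
    obtain rfl : (fun i => (p i).2) = y := funext hpy
    refine ⟨_, ⟨fun i => (p i).1, fun i => ⟨p i, hp i, rfl⟩, rfl⟩, ?_⟩
    rw [dist_comm]
    exact hdist p hp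

/-- For an `L`-stable `n`-valuation `ν`, a correspondence `R` between finite
metric spaces `X` and `Y`, and any nonempty `S ⊆ R`,
`|ν (K_n (π₁ S)) − ν (K_n (π₂ S))| ≤ L · dis R`. -/
theorem stable_valuation_correspondence_bound (n : ℕ) (hn : 1 ≤ n) (L : ℝ) (hL : 0 ≤ L)
    (ν : Set (Fin n → Fin n → ℝ) → ℝ)
    (hν_nonneg : ∀ A : Set (Fin n → Fin n → ℝ), A.Finite → A.Nonempty → 0 ≤ ν A)
    (hν_mono : ∀ A B : Set (Fin n → Fin n → ℝ), A.Finite → B.Finite →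
      A.Nonempty → A ⊆ B → ν A ≤ ν B)
    (hν_stable : ∀ A B : Set (Fin n → Fin n → ℝ), A.Finite → B.Finite →
      A.Nonempty → B.Nonempty → |ν A - ν B| ≤ L * hausdorffDist A B)
    (X Y : Type) [MetricSpace X] [Fintype X] [Nonempty X]
    [MetricSpace Y] [Fintype Y] [Nonempty Y]
    (R : Set (X × Y))
    (hR1 : ∀ x : X, ∃ y : Y, (x, y) ∈ R) (hR2 : ∀ y : Y, ∃ x : X, (x, y) ∈ R)
    (S : Set (X × Y)) (hS : S.Nonempty) (hSR : S ⊆ R) :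
    |ν (curvSet X n (Prod.fst '' S)) - ν (curvSet Y n (Prod.snd '' S))| ≤ L * dis R := by
  exact (hν_stable _ _ (curvSet_finite X n _) (curvSet_finite Y n _)
    (curvSet_nonempty n (hS.image _)) (curvSet_nonempty n (hS.image _))).trans
    (mul_le_mul_of_nonneg_left (hausdorffDist_curvSet_le_dis n hSR) hL)
end

section
/- For every k ≥ 2, the k-th ultrametricity valuation ν_{ult_k} is 2-stable: for all finite nonempty subsets A, B ⊆ ℝ^{k×k}, |ν_{ult_k}(A) − ν_{ult_k}(B)| ≤ 2 · d_H(A, B). Moreover, for every finite metric space X and nonempty σ ⊆ X, ult_k(σ) = ν_{ult_k}(K_k(σ)), so the k-th ultrametricity filtration is k-local. -/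
open Set Metric

/-- The `k`-th ultrametricity of a subset `σ` of a metric space:
`ult_k(σ) = max_{x₁,…,x_k ∈ σ} (d(x₁,x_k) − max_{2≤i≤k} d(x_{i−1},x_i))`,
written with 0-indexed tuples `x 0, …, x (k-1)`. -/
noncomputable def ultK {X : Type} [MetricSpace X] (k : ℕ) (σ : Set X) : ℝ :=
  sSup { t | ∃ x : ℕ → X, (∀ i < k, x i ∈ σ) ∧
    t = dist (x 0) (x (k - 1)) -
      sSup { s | ∃ i, 1 ≤ i ∧ i < k ∧ s = dist (x (i - 1)) (x i) } }

/-- The `k`-th ultrametricity valuation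
`ν_{ult_k}(A) = max_{a∈A} (a_{1k} − max_{2≤i≤k} a_{i−1,i})` (0-indexed entries). -/
noncomputable def nuUltK (k : ℕ) (hk : 0 < k) (A : Set (Fin k → Fin k → ℝ)) : ℝ :=
  sSup { t | ∃ a ∈ A,
    t = a ⟨0, hk⟩ ⟨k - 1, by omega⟩ -
      sSup { s | ∃ i : ℕ, ∃ h : 1 ≤ i ∧ i < k, s = a ⟨i - 1, by omega⟩ ⟨i, h.2⟩ } }

/-- The quantity `a_{1k} − max_{2≤i≤k} a_{i−1,i}` of a single matrix `a`. -/
noncomputable def ultGap (k : ℕ) (hk : 0 < k) (a : Fin k → Fin k → ℝ) : ℝ :=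
  a ⟨0, hk⟩ ⟨k - 1, by omega⟩ -
    sSup { s | ∃ i : ℕ, ∃ h : 1 ≤ i ∧ i < k, s = a ⟨i - 1, by omega⟩ ⟨i, h.2⟩ }

theorem nuUltK_eq_sSup_image (k : ℕ) (hk : 0 < k) (A : Set (Fin k → Fin k → ℝ)) :
    nuUltK k hk A = sSup (ultGap k hk '' A) := by
  unfold nuUltK
  congr 1
  ext t
  constructor <;> rintro ⟨a, ha, h⟩ <;> exact ⟨a, ha, h.symm⟩

theorem dist_entry_le {k : ℕ} (a b : Fin k → Fin k → ℝ) (i j : Fin k) :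
    |a i j - b i j| ≤ dist a b :=
  (Real.dist_eq _ _).symm.le.trans ((dist_le_pi_dist (a i) (b i) j).trans (dist_le_pi_dist a b i))

theorem bddAbove_superdiagonal {k : ℕ} (a : Fin k → Fin k → ℝ) :
    BddAbove { s | ∃ i : ℕ, ∃ h : 1 ≤ i ∧ i < k, s = a ⟨i - 1, by omega⟩ ⟨i, h.2⟩ } := by
  refine ((Set.finite_range fun p : Fin k × Fin k => a p.1 p.2).subset ?_).bddAbove
  rintro s ⟨i, h, rfl⟩
  exact ⟨(⟨i - 1, by omega⟩, ⟨i, h.2⟩), rfl⟩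

theorem ultGap_le_add {k : ℕ} (hk₀ : 0 < k) (hk : 2 ≤ k) (a b : Fin k → Fin k → ℝ) :
    ultGap k hk₀ a ≤ ultGap k hk₀ b + 2 * dist a b := by
  have hsup : sSup { s | ∃ i : ℕ, ∃ h : 1 ≤ i ∧ i < k, s = b ⟨i - 1, by omega⟩ ⟨i, h.2⟩ } ≤
      sSup { s | ∃ i : ℕ, ∃ h : 1 ≤ i ∧ i < k, s = a ⟨i - 1, by omega⟩ ⟨i, h.2⟩ } + dist a b := by
    refine csSup_le ⟨_, 1, ⟨le_rfl, by omega⟩, rfl⟩ ?_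
    rintro s ⟨i, h, rfl⟩
    have hle := le_csSup (bddAbove_superdiagonal a) ⟨i, h, rfl⟩
    have hdist := abs_le.1 (dist_entry_le a b ⟨i - 1, by omega⟩ ⟨i, h.2⟩)
    linarith [hdist.1]
  have hdist := abs_le.1 (dist_entry_le a b ⟨0, hk₀⟩ ⟨k - 1, by omega⟩)
  unfold ultGap
  linarith [hdist.2]

/-- The supremum of a function over a finite set varies with the Hausdorff distance at the rate
at which the function varies with the distance. -/
theorem sSup_image_le_add_hausdorffDist {E : Type*} [PseudoMetricSpace E] {f : E → ℝ} {c : ℝ}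
    (hc : 0 ≤ c) (hf : ∀ a b, f a ≤ f b + c * dist a b) {A B : Set E}
    (hA : A.Finite) (hB : B.Finite) (hA' : A.Nonempty) (hB' : B.Nonempty) :
    sSup (f '' A) ≤ sSup (f '' B) + c * hausdorffDist A B := by
  refine csSup_le (hA'.image f) ?_
  rintro _ ⟨a, ha, rfl⟩
  obtain ⟨b, hb, hab⟩ := hB.isCompact.exists_infDist_eq_dist hB' a
  have hle : dist a b ≤ hausdorffDist A B := hab ▸ infDist_le_hausdorffDist_of_mem ha
    (hausdorffEDist_ne_top_of_nonempty_of_bounded hA' hB' hA.isBounded hB.isBounded)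
  have hsup := le_csSup (hB.image f).bddAbove (Set.mem_image_of_mem f hb)
  have hmul := mul_le_mul_of_nonneg_left hle hc
  linarith [hf a b]

theorem ultK_eq_nuUltK_curvSet {X : Type} [MetricSpace X] (k : ℕ) (hk : 0 < k) (σ : Set X) :
    ultK k σ = nuUltK k hk (curvSet X k σ) := by
  unfold ultK nuUltK
  congr 1
  ext t
  constructor
  · rintro ⟨x, hx, rfl⟩
    refine ⟨_, ⟨fun i => x i, fun i => hx i i.2, rfl⟩, ?_⟩
    simp only [exists_prop, and_assoc]
  · rintro ⟨_, ⟨x, hx, rfl⟩, rfl⟩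
    refine ⟨fun i => if h : i < k then x ⟨i, h⟩ else x ⟨0, hk⟩, fun i hi => ?_, ?_⟩
    · simpa [hi] using hx _
    · have hk' : k - 1 < k := by omega
      simp only [hk, hk', dif_pos]
      congr 2
      ext s
      constructor
      · rintro ⟨i, h, rfl⟩
        have h' : i - 1 < k := by omega
        exact ⟨i, h.1, h.2, by simp only [h', h.2, dif_pos]⟩
      · rintro ⟨i, h₁, h₂, rfl⟩
        have h' : i - 1 < k := by omega
        exact ⟨i, ⟨h₁, h₂⟩, by simp only [h', h₂, dif_pos]⟩

/-- for `k ≥ 2`, the valuation `ν_{ult_k}` is 2-stable, and for every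
finite metric space `X` and nonempty `σ ⊆ X`, `ult_k(σ) = ν_{ult_k}(K_k(σ))`,
so the `k`-th ultrametricity filtration is `k`-local. -/
theorem nuUltK_two_stable_and_ultK_local (k : ℕ) (hk : 2 ≤ k) :
    (∀ A B : Set (Fin k → Fin k → ℝ), A.Finite → B.Finite → A.Nonempty → B.Nonempty →
      |nuUltK k (by omega) A - nuUltK k (by omega) B| ≤ 2 * hausdorffDist A B) ∧
    (∀ (X : Type) [MetricSpace X] [Fintype X] [Nonempty X] (σ : Set X), σ.Nonempty →
      ultK k σ = nuUltK k (by omega) (curvSet X k σ)) := by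
  refine ⟨fun A B hA hB hA' hB' => ?_, fun X _ _ _ σ _ => ultK_eq_nuUltK_curvSet k _ σ⟩
  rw [nuUltK_eq_sSup_image, nuUltK_eq_sSup_image, abs_sub_le_iff]
  have hAB := sSup_image_le_add_hausdorffDist zero_le_two (ultGap_le_add (by omega) hk) hA hB hA' hB'
  have hBA := sSup_image_le_add_hausdorffDist zero_le_two (ultGap_le_add (by omega) hk) hB hA hB' hA'
  rw [hausdorffDist_comm] at hBA
  constructor <;> linarith
end

section
/- For integers k > ℓ ≥ 3, let X_k = {1, 2, …, k} ⊆ ℝ with the metric d(i,j) = |i − j|. Then ult_k(X_k) = k − 2 while ult_ℓ(X_k) < k − 2. In particular ult_k and ult_ℓ are different functions on finite metric spaces. -/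
open Set Metric

/-- A path of `m` points whose steps have length at most `c` has length at most `(m - 1) * c`. -/
theorem dist_le_mul_of_steps_le {X : Type} [MetricSpace X] {x : ℕ → X} {m : ℕ} (hm : 1 ≤ m) {c : ℝ}
    (h : ∀ i, 1 ≤ i → i < m → dist (x (i - 1)) (x i) ≤ c) :
    dist (x 0) (x (m - 1)) ≤ ((m : ℝ) - 1) * c := by
  have key : dist (x 0) (x (m - 1)) ≤ ∑ i ∈ Finset.range (m - 1), c := by
    refine dist_le_range_sum_of_dist_le (m - 1) fun {i} hi => ?_
    simpa using h (i + 1) (by omega) (by omega)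
  simpa [Nat.cast_sub hm] using key

/-- Two points of `{1, …, k}` are at distance at most `k - 1`. -/
theorem dist_le_of_mem_interval {k : ℕ} {a b : ℝ}
    (ha : a ∈ (fun i : ℕ => (i : ℝ)) '' { i : ℕ | 1 ≤ i ∧ i ≤ k })
    (hb : b ∈ (fun i : ℕ => (i : ℝ)) '' { i : ℕ | 1 ≤ i ∧ i ≤ k }) :
    dist a b ≤ (k : ℝ) - 1 := by
  obtain ⟨p, ⟨hp1, hpk⟩, rfl⟩ := ha
  obtain ⟨q, ⟨hq1, hqk⟩, rfl⟩ := hb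
  have : (1 : ℝ) ≤ p := by exact_mod_cast hp1
  have : (1 : ℝ) ≤ q := by exact_mod_cast hq1
  have : (p : ℝ) ≤ k := by exact_mod_cast hpk
  have : (q : ℝ) ≤ k := by exact_mod_cast hqk
  rw [Real.dist_eq, abs_le]
  constructor <;> linarith

/-- Distances between points of `{1, …, k}` are natural numbers. -/
theorem exists_nat_dist_of_mem_interval {k : ℕ} {a b : ℝ}
    (ha : a ∈ (fun i : ℕ => (i : ℝ)) '' { i : ℕ | 1 ≤ i ∧ i ≤ k })
    (hb : b ∈ (fun i : ℕ => (i : ℝ)) '' { i : ℕ | 1 ≤ i ∧ i ≤ k }) :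
    ∃ n : ℕ, dist a b = n := by
  obtain ⟨p, -, rfl⟩ := ha
  obtain ⟨q, -, rfl⟩ := hb
  refine ⟨((p : ℤ) - q).natAbs, ?_⟩
  simp [Real.dist_eq, Nat.cast_natAbs]

/-- The steps of a path in `{1, …, k}` are bounded by `k - 1`. -/
theorem bddAbove_steps {k m : ℕ} {x : ℕ → ℝ}
    (hx : ∀ i < m, x i ∈ (fun i : ℕ => (i : ℝ)) '' { i : ℕ | 1 ≤ i ∧ i ≤ k }) :
    BddAbove { s | ∃ i, 1 ≤ i ∧ i < m ∧ s = dist (x (i - 1)) (x i) } := by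
  refine ⟨(k : ℝ) - 1, ?_⟩
  rintro _ ⟨i, hi1, him, rfl⟩
  exact dist_le_of_mem_interval (hx _ (by omega)) (hx _ him)

/-- The largest step of a path is nonnegative. -/
theorem sSup_steps_nonneg {m : ℕ} (x : ℕ → ℝ) :
    0 ≤ sSup { s | ∃ i, 1 ≤ i ∧ i < m ∧ s = dist (x (i - 1)) (x i) } := by
  refine Real.sSup_nonneg ?_
  rintro _ ⟨i, -, -, rfl⟩
  exact dist_nonneg

/-- If no step of a path in `{1, …, k}` exceeds the natural number `n`, its `m` points
satisfy the corresponding length bound; otherwise its largest step is at least `n + 1`. -/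
theorem steps_dichotomy {k m : ℕ} (hm : 1 ≤ m) {x : ℕ → ℝ}
    (hx : ∀ i < m, x i ∈ (fun i : ℕ => (i : ℝ)) '' { i : ℕ | 1 ≤ i ∧ i ≤ k }) (n : ℕ) :
    (n : ℝ) + 1 ≤ sSup { s | ∃ i, 1 ≤ i ∧ i < m ∧ s = dist (x (i - 1)) (x i) } ∨
      dist (x 0) (x (m - 1)) ≤ ((m : ℝ) - 1) * n := by
  by_cases h : ∀ i, 1 ≤ i → i < m → dist (x (i - 1)) (x i) ≤ n
  · exact Or.inr (dist_le_mul_of_steps_le hm h)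
  · push Not at h
    obtain ⟨i, hi1, him, hi⟩ := h
    refine Or.inl (le_trans ?_ (le_csSup (bddAbove_steps hx) ⟨i, hi1, him, rfl⟩))
    obtain ⟨d, hd⟩ := exists_nat_dist_of_mem_interval (hx (i - 1) (by omega)) (hx i him)
    rw [hd] at hi ⊢
    exact_mod_cast hi

/-- The set of values defining `ultK` on `{1, …, k}` is nonempty. -/
theorem ultK_values_nonempty {k : ℕ} (hk : 1 ≤ k) (m : ℕ) :
    { t | ∃ x : ℕ → ℝ,
      (∀ i < m, x i ∈ (fun i : ℕ => (i : ℝ)) '' { i : ℕ | 1 ≤ i ∧ i ≤ k }) ∧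
      t = dist (x 0) (x (m - 1)) -
        sSup { s | ∃ i, 1 ≤ i ∧ i < m ∧ s = dist (x (i - 1)) (x i) } }.Nonempty :=
  ⟨_, fun _ => 1, fun _ _ => ⟨1, ⟨le_rfl, hk⟩, by simp⟩, rfl⟩

/-- For `k > ℓ ≥ 3`, on the space `X_k = {1,…,k} ⊆ ℝ` (with the metric
`d(i,j) = |i − j|` inherited from `ℝ`), one has `ult_k(X_k) = k − 2` while
`ult_ℓ(X_k) < k − 2`.  In particular `ult_k` and `ult_ℓ` are different functions. -/
theorem ultK_differ_on_interval (k l : ℕ) (hl : 3 ≤ l) (hlk : l < k) :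
    ultK k ((fun i : ℕ => (i : ℝ)) '' { i : ℕ | 1 ≤ i ∧ i ≤ k }) = (k : ℝ) - 2 ∧
    ultK l ((fun i : ℕ => (i : ℝ)) '' { i : ℕ | 1 ≤ i ∧ i ≤ k }) < (k : ℝ) - 2 := by
  have hl' : (3 : ℝ) ≤ l := by exact_mod_cast hl
  have hlk' : (l : ℝ) + 1 ≤ k := by exact_mod_cast hlk
  constructor
  · refine IsGreatest.csSup_eq ⟨⟨fun i => (i : ℝ) + 1, fun i hi => ?_, ?_⟩, ?_⟩
    · exact ⟨i + 1, ⟨by omega, by omega⟩, by simp⟩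
    · have hsteps : { s : ℝ | ∃ i : ℕ, 1 ≤ i ∧ i < k ∧
          s = dist (((i - 1 : ℕ) : ℝ) + 1) ((i : ℝ) + 1) } = {1} := by
        ext s
        constructor
        · rintro ⟨i, hi, -, rfl⟩
          simp [Nat.cast_sub hi]
        · rintro rfl
          exact ⟨1, le_rfl, by omega, by simp⟩
      rw [hsteps, csSup_singleton, Real.dist_eq]
      beta_reduce
      rw [Nat.cast_sub (by omega : 1 ≤ k), abs_sub_comm,
        abs_of_nonneg] <;> push_cast <;> linarith
    · rintro _ ⟨x, hx, rfl⟩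
      have hd := dist_le_of_mem_interval (hx 0 (by omega)) (hx (k - 1) (by omega))
      have hnn := sSup_steps_nonneg (m := k) x
      rcases steps_dichotomy (by omega) hx 0 with h | h <;> push_cast at h <;> linarith
  · refine lt_of_le_of_lt (csSup_le (ultK_values_nonempty (by omega) l) ?_)
      (show (k : ℝ) - 3 < (k : ℝ) - 2 by linarith)
    rintro _ ⟨x, hx, rfl⟩
    have hd := dist_le_of_mem_interval (hx 0 (by omega)) (hx (l - 1) (by omega))
    have hnn := sSup_steps_nonneg (m := l) x
    rcases steps_dichotomy (by omega) hx 0 with h₀ | h₀ <;>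
      rcases steps_dichotomy (by omega) hx 1 with h₁ | h₁ <;>
      push_cast at h₀ h₁ <;> linarith
end

section
/- The Čech filtration is not local: for every n ≥ 1, there is no function ν from finite nonempty subsets of ℝ^{n×n} to ℝ such that for every finite metric space X and every nonempty subset σ ⊆ X one has C_X(σ) = ν(K_n(σ)), where C_X(σ) = min_{p∈X} max_{x∈σ} d_X(p,x). -/
open Set Metric

/-- The Čech filtration value of a nonempty subset `σ` of a finite metric space `X`:
`C_X(σ) = min_{p∈X} max_{x∈σ} d(p,x)`. -/
noncomputable def cech {X : Type} [MetricSpace X] (σ : Set X) : ℝ :=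
  sInf { t | ∃ p : X, t = sSup { s | ∃ x ∈ σ, s = dist p x } }

/-- Curvature sets are invariant under isometric embeddings. -/
theorem curvSet_image {X Y : Type} [MetricSpace X] [MetricSpace Y] {f : X → Y}
    (hf : Isometry f) (n : ℕ) (σ : Set X) : curvSet Y n (f '' σ) = curvSet X n σ := by
  ext A
  constructor
  · rintro ⟨y, hy, rfl⟩
    choose x hx hxy using hy
    exact ⟨x, hx, by simp only [← hxy, hf.dist_eq]⟩
  · rintro ⟨x, hx, rfl⟩
    exact ⟨f ∘ x, fun i => mem_image_of_mem f (hx i), by simp [hf.dist_eq]⟩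

/-- The Čech value of a pair `{a, b}` is `r` as soon as the minimum over `p` of
`max (dist p a) (dist p b)` is attained with value `r`. -/
theorem cech_pair_eq {X : Type} [MetricSpace X] {a b : X} {r : ℝ}
    (hr : IsLeast (range fun p : X => max (dist p a) (dist p b)) r) : cech {a, b} = r := by
  have hsup (p : X) : sSup { s | ∃ x ∈ ({a, b} : Set X), s = dist p x } =
      max (dist p a) (dist p b) := by
    rw [← csSup_pair]
    congr 1
    ext s
    simp
  rw [← hr.csInf_eq, cech]
  congr 1
  ext t
  simp only [hsup, mem_ofPred_eq, mem_range, eq_comm]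

/-- The Čech filtration is not local: for every `n ≥ 1` there is no map
`ν` on sets of `n × n` matrices such that `C_X(σ) = ν(K_n(σ))` for every finite metric
space `X` and every nonempty `σ ⊆ X`. -/
theorem cech_not_local (n : ℕ) (hn : 1 ≤ n) :
    ¬ ∃ ν : Set (Fin n → Fin n → ℝ) → ℝ,
      ∀ (X : Type) [MetricSpace X] [Fintype X] [Nonempty X] (σ : Set X),
        σ.Nonempty → cech σ = ν (curvSet X n σ) := by
  rintro ⟨ν, hν⟩
  let Y : Set ℝ := {0, 2}
  let Z : Set ℝ := {0, 1, 2}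
  have hYZ : Y ⊆ Z := by rintro x (rfl | rfl) <;> simp [Z]
  have : Fintype Y := (toFinite ({0, 2} : Set ℝ)).fintype
  have : Fintype Z := (toFinite ({0, 1, 2} : Set ℝ)).fintype
  let a : Y := ⟨0, by simp [Y]⟩
  let b : Y := ⟨2, by simp [Y]⟩
  let m : Z := ⟨1, by simp [Z]⟩
  have : Nonempty Y := ⟨a⟩
  have : Nonempty Z := ⟨m⟩
  let f : Y → Z := inclusion hYZ
  have hf : Isometry f := Isometry.of_dist_eq fun _ _ => rfl
  have hY : cech ({a, b} : Set Y) = 2 := by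
    refine cech_pair_eq ⟨⟨a, ?_⟩, ?_⟩
    · norm_num [a, b, Subtype.dist_eq, Real.dist_eq]
    · rintro _ ⟨⟨p, rfl | rfl⟩, rfl⟩ <;> norm_num [a, b, Subtype.dist_eq, Real.dist_eq]
  have hZ : cech ({f a, f b} : Set Z) = 1 := by
    refine cech_pair_eq ⟨⟨m, ?_⟩, ?_⟩
    · norm_num [f, a, b, m, Subtype.dist_eq, Real.dist_eq]
    · rintro _ ⟨⟨p, rfl | rfl | rfl⟩, rfl⟩ <;>
        norm_num [f, a, b, Subtype.dist_eq, Real.dist_eq]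
  have hYν := hν Y {a, b} (insert_nonempty _ _)
  have hZν := hν Z {f a, f b} (insert_nonempty _ _)
  rw [← image_pair, curvSet_image hf, ← hYν, image_pair, hY, hZ] at hZν
  norm_num at hZν
end

section
/- Let n, ℓ ≥ 1, L, K ≥ 0, let X be a finite metric space, and let x, x' ∈ X. Let ν be a map from pairs (a finite nonempty subset of ℝ^{(n+1)×(n+1)}, a vector in ℝ^ℓ) to ℝ₊ satisfying |ν(A,v) − ν(B,w)| ≤ L·max{d_H(A,B), ‖v−w‖_∞} for all finite nonempty A, B and all v, w, and let ρ : X → ℝ^ℓ satisfy ‖ρ(x) − ρ(x')‖_∞ ≤ K·d_X(x,x'). Then for every nonempty σ ⊆ X, |ν(K_n(x,σ), ρ(x)) − ν(K_n(x',σ), ρ(x'))| ≤ L·max{1, K}·d_X(x,x'); in particular d_H(K_n(x,σ), K_n(x',σ)) ≤ d_X(x,x'). -/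
open Set Metric

/-- The basepoint `n`-th curvature set `K_n(x₀, σ) ⊆ ℝ^{(n+1)×(n+1)}`: distance
matrices of tuples `(z₀, z₁, …, z_n)` with `z₀ = x₀` and `z₁, …, z_n ∈ σ`. -/
def bCurvSet {X : Type} [MetricSpace X] (n : ℕ) (x₀ : X) (σ : Set X) :
    Set (Fin (n + 1) → Fin (n + 1) → ℝ) :=
  { A | ∃ z : Fin (n + 1) → X, z 0 = x₀ ∧ (∀ i : Fin (n + 1), i ≠ 0 → z i ∈ σ) ∧
      A = fun i j => dist (z i) (z j) }

/-- Moving the basepoint from `x` to `x'` moves each matrix of the basepoint curvature set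
by at most `dist x x'`. -/
theorem exists_mem_bCurvSet_dist_le {X : Type} [MetricSpace X] {n : ℕ} (x x' : X) {σ : Set X}
    {A : Fin (n + 1) → Fin (n + 1) → ℝ} (hA : A ∈ bCurvSet n x σ) :
    ∃ B ∈ bCurvSet n x' σ, dist A B ≤ dist x x' := by
  obtain ⟨z, rfl, hz, rfl⟩ := hA
  refine ⟨_, ⟨Function.update z 0 x', by simp, fun i hi => by simpa [hi] using hz i hi, rfl⟩, ?_⟩
  refine (dist_pi_le_iff dist_nonneg).2 fun i => (dist_pi_le_iff dist_nonneg).2 fun j => ?_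
  by_cases hi : i = 0 <;> by_cases hj : j = 0
  · subst hi hj
    simp
  · subst hi
    simpa [hj] using dist_dist_dist_le_left (z 0) x' (z j)
  · subst hj
    simpa [hi] using dist_dist_dist_le_right (z i) (z 0) x'
  · simp [hi, hj]

theorem hausdorffDist_bCurvSet_le {X : Type} [MetricSpace X] (n : ℕ) (x x' : X) (σ : Set X) :
    hausdorffDist (bCurvSet n x σ) (bCurvSet n x' σ) ≤ dist x x' :=
  hausdorffDist_le_of_mem_dist dist_nonneg
    (fun _ hA => exists_mem_bCurvSet_dist_le x x' hA)
    (fun _ hA => by simpa only [dist_comm x x'] using exists_mem_bCurvSet_dist_le x' x hA)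

theorem finite_bCurvSet {X : Type} [MetricSpace X] [Finite X] (n : ℕ) (x : X) (σ : Set X) :
    (bCurvSet n x σ).Finite := by
  refine (Set.finite_range fun (z : Fin (n + 1) → X) i j => dist (z i) (z j)).subset ?_
  rintro _ ⟨z, -, -, rfl⟩
  exact ⟨z, rfl⟩

theorem nonempty_bCurvSet {X : Type} [MetricSpace X] (n : ℕ) (x : X) {σ : Set X}
    (hσ : σ.Nonempty) : (bCurvSet n x σ).Nonempty := by
  obtain ⟨s, hs⟩ := hσ
  exact ⟨_, Function.update (fun _ => s) 0 x, by simp, fun i hi => by simpa [hi] using hs, rfl⟩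

/-- stability of local basepoint filtrations under change of basepoint.
For an `L`-stable adjusted valuation `ν` and a `K`-Lipschitz point descriptor `ρ`,
for every nonempty `σ ⊆ X`,
`|ν(K_n(x,σ), ρ x) − ν(K_n(x',σ), ρ x')| ≤ L·max{1,K}·d(x,x')`; in particular
`d_H(K_n(x,σ), K_n(x',σ)) ≤ d(x,x')`. -/
theorem basepoint_change_stability (n l : ℕ) (hn : 1 ≤ n) (hl : 1 ≤ l)
    (L K : ℝ) (hL : 0 ≤ L) (hK : 0 ≤ K)
    (X : Type) [MetricSpace X] [Fintype X] [Nonempty X] (x x' : X)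
    (ν : Set (Fin (n + 1) → Fin (n + 1) → ℝ) → (Fin l → ℝ) → ℝ)
    (hν_nonneg : ∀ A, A.Finite → A.Nonempty → ∀ v, 0 ≤ ν A v)
    (hν_stable : ∀ A B : Set (Fin (n + 1) → Fin (n + 1) → ℝ),
      A.Finite → B.Finite → A.Nonempty → B.Nonempty → ∀ v w : Fin l → ℝ,
      |ν A v - ν B w| ≤ L * max (hausdorffDist A B) (dist v w))
    (ρ : X → Fin l → ℝ) (hρ : dist (ρ x) (ρ x') ≤ K * dist x x')
    (σ : Set X) (hσ : σ.Nonempty) :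
    |ν (bCurvSet n x σ) (ρ x) - ν (bCurvSet n x' σ) (ρ x')| ≤
      L * max 1 K * dist x x' ∧
    hausdorffDist (bCurvSet n x σ) (bCurvSet n x' σ) ≤ dist x x' := by
  have hH := hausdorffDist_bCurvSet_le n x x' σ
  refine ⟨?_, hH⟩
  refine (hν_stable _ _ (finite_bCurvSet n x σ) (finite_bCurvSet n x' σ)
    (nonempty_bCurvSet n x hσ) (nonempty_bCurvSet n x' hσ) (ρ x) (ρ x')).trans ?_
  rw [mul_assoc, max_mul_of_nonneg _ _ dist_nonneg, one_mul]
  exact mul_le_mul_of_nonneg_left (max_le_max hH hρ) hL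
end

section
/- Let n ≥ 2. For every finite metric space X and every nonempty subset σ ⊆ X, ω_{n,1}(K_n(σ)) = (1/2) · diam(σ). That is, the filtration induced by the 1-point valuation equals one half of the Vietoris-Rips filtration. -/
open Set Metric

/-- The diameter of a subset `σ` of a metric space. -/
noncomputable def sdiam {X : Type} [MetricSpace X] (σ : Set X) : ℝ :=
  sSup { t | ∃ x ∈ σ, ∃ x' ∈ σ, t = dist x x' }

/-- The 1-point valuation `ω_{n,1}(A) = inf_{p ∈ ℝ^{n×n}} max_{α∈A} ‖α − p‖_∞`. -/
noncomputable def omegaOne (n : ℕ) (A : Set (Fin n → Fin n → ℝ)) : ℝ :=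
  sInf { t | ∃ p : Fin n → Fin n → ℝ, t = sSup { s | ∃ α ∈ A, s = dist α p } }

/-- Distances within `σ` are bounded by `sdiam σ` when the ambient space is finite. -/
theorem dist_le_sdiam {X : Type} [MetricSpace X] [Finite X] {σ : Set X} {x y : X}
    (hx : x ∈ σ) (hy : y ∈ σ) : dist x y ≤ sdiam σ := by
  refine le_csSup ?_ ⟨x, hx, y, hy, rfl⟩
  refine ((Set.finite_range fun q : X × X => dist q.1 q.2).subset ?_).bddAbove
  rintro t ⟨a, -, b, -, rfl⟩
  exact ⟨(a, b), rfl⟩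

theorem sdiam_nonneg {X : Type} [MetricSpace X] (σ : Set X) : 0 ≤ sdiam σ := by
  refine Real.sSup_nonneg ?_
  rintro t ⟨a, -, b, -, rfl⟩
  exact dist_nonneg

/-- Every center `p` is at distance at least half the diameter from some point of the
curvature set. -/
theorem half_sdiam_le_sSup_dist {X : Type} [MetricSpace X] [Finite X] {n : ℕ} (hn : 2 ≤ n)
    {σ : Set X} (hσ : σ.Nonempty) (p : Fin n → Fin n → ℝ) :
    (1 / 2) * sdiam σ ≤ sSup { s | ∃ α ∈ curvSet X n σ, s = dist α p } := by
  have hbdd : BddAbove { s | ∃ α ∈ curvSet X n σ, s = dist α p } := by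
    refine (((curvSet_finite X n σ).image fun α => dist α p).subset ?_).bddAbove
    rintro s ⟨α, hα, rfl⟩
    exact ⟨α, hα, rfl⟩
  obtain ⟨z, hz⟩ := hσ
  suffices h : sdiam σ ≤ 2 * sSup { s | ∃ α ∈ curvSet X n σ, s = dist α p } by linarith
  refine csSup_le ⟨_, z, hz, z, hz, rfl⟩ ?_
  rintro t ⟨x, hx, y, hy, rfl⟩
  let i : Fin n := ⟨0, by omega⟩
  let j : Fin n := ⟨1, by omega⟩
  have hij : j ≠ i := by simp [i, j]
  let u : Fin n → X := fun k => if k = i then x else y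
  have hu : ∀ k, u k ∈ σ := fun k => by
    by_cases hk : k = i <;> simp [u, hk, hx, hy]
  let α : Fin n → Fin n → ℝ := fun k l => dist (u k) (u l)
  let β : Fin n → Fin n → ℝ := fun _ _ => dist x x
  have hα := le_csSup hbdd ⟨α, ⟨u, hu, rfl⟩, rfl⟩
  have hβ := le_csSup hbdd ⟨β, ⟨fun _ => x, fun _ => hx, rfl⟩, rfl⟩
  have hle : dist x y ≤ dist α β := by
    calc dist x y = dist (α i j) (β i j) := by
          simp [α, β, u, hij]
      _ ≤ dist (α i) (β i) := dist_le_pi_dist _ _ j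
      _ ≤ dist α β := dist_le_pi_dist _ _ i
  linarith [dist_triangle_right α β p]

/-- The constant matrix with value half the diameter is within half the diameter of the
curvature set. -/
theorem sSup_dist_const_le_half_sdiam (X : Type) [MetricSpace X] [Finite X] (n : ℕ)
    (σ : Set X) :
    sSup { s | ∃ α ∈ curvSet X n σ,
      s = dist α (fun _ _ : Fin n => (1 / 2) * sdiam σ) } ≤ (1 / 2) * sdiam σ := by
  have h0 : 0 ≤ (1 / 2) * sdiam σ := by linarith [sdiam_nonneg σ]
  refine Real.sSup_le ?_ h0
  rintro s ⟨α, ⟨x, hx, rfl⟩, rfl⟩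
  refine (dist_pi_le_iff h0).2 fun i => (dist_pi_le_iff h0).2 fun j => ?_
  have h1 := dist_le_sdiam (hx i) (hx j)
  have h2 : 0 ≤ dist (x i) (x j) := dist_nonneg
  rw [Real.dist_eq, abs_le]
  constructor <;> linarith

/-- For `n ≥ 2`, every finite metric space `X`, and every nonempty
`σ ⊆ X`, `ω_{n,1}(K_n(σ)) = (1/2) · diam(σ)`: the filtration induced by the
1-point valuation is half of the Vietoris–Rips filtration. -/
theorem omegaOne_curvSet_eq_half_diam (n : ℕ) (hn : 2 ≤ n)
    (X : Type) [MetricSpace X] [Fintype X] [Nonempty X]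
    (σ : Set X) (hσ : σ.Nonempty) :
    omegaOne n (curvSet X n σ) = (1 / 2) * sdiam σ := by
  refine le_antisymm ?_ ?_
  · refine le_trans (csInf_le ?_ ⟨fun _ _ => (1 / 2) * sdiam σ, rfl⟩)
      (sSup_dist_const_le_half_sdiam X n σ)
    refine ⟨(1 / 2) * sdiam σ, ?_⟩
    rintro t ⟨p, rfl⟩
    exact half_sdiam_le_sSup_dist hn hσ p
  · refine le_csInf ⟨_, fun _ _ => 0, rfl⟩ ?_
    rintro t ⟨p, rfl⟩
    exact half_sdiam_le_sSup_dist hn hσ p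
end

section
/- Let n ≥ 2 and let ν be a strongly increasing, 1-stable n-valuation. Then: (i) ν(A) = ν({max A}) for every finite nonempty A ⊆ ℝ^{n×n}, where max A is the entrywise maximum of the matrices in A; and (ii) defining f_ν(r) = ν({M(r)}), where M(r) ∈ ℝ^{n×n} has all off-diagonal entries equal to r and zero diagonal, the function f_ν : ℝ → ℝ is 1-Lipschitz and for every finite metric space X and every nonempty σ ⊆ X, ν(K_n(σ)) = f_ν(diam(σ)). -/
open Set Metric

/-- The entrywise maximum matrix of a set `A ⊆ ℝ^{n×n}`. -/
noncomputable def maxMat {n : ℕ} (A : Set (Fin n → Fin n → ℝ)) :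
    Fin n → Fin n → ℝ :=
  fun i j => sSup { t | ∃ α ∈ A, t = α i j }

/-- The matrix `M(r)` with zero diagonal and all off-diagonal entries equal to `r`. -/
def diagZero (n : ℕ) (r : ℝ) : Fin n → Fin n → ℝ :=
  fun i j => if i = j then 0 else r

/-- A strongly increasing 1-stable valuation respects the non-strict entrywise comparison. -/
theorem le_of_forall_entry_le {n : ℕ} {ν : Set (Fin n → Fin n → ℝ) → ℝ}
    (hν_strong : ∀ A B : Set (Fin n → Fin n → ℝ), A.Finite → B.Finite →
      A.Nonempty → B.Nonempty →
      (∀ α ∈ A, ∀ i j : Fin n, ∃ β ∈ B, α i j < β i j) → ν A ≤ ν B)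
    (hν_stable : ∀ A B : Set (Fin n → Fin n → ℝ), A.Finite → B.Finite →
      A.Nonempty → B.Nonempty → |ν A - ν B| ≤ hausdorffDist A B)
    {A B : Set (Fin n → Fin n → ℝ)} (hA : A.Finite) (hB : B.Finite)
    (hA' : A.Nonempty) (hB' : B.Nonempty)
    (h : ∀ α ∈ A, ∀ i j : Fin n, ∃ β ∈ B, α i j ≤ β i j) : ν A ≤ ν B := by
  refine le_of_forall_pos_le_add fun ε hε => ?_
  let T : (Fin n → Fin n → ℝ) → (Fin n → Fin n → ℝ) := fun β i j => β i j + ε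
  have hT : ∀ β, dist (T β) β ≤ ε := fun β => by
    refine (dist_pi_le_iff hε.le).2 fun i => (dist_pi_le_iff hε.le).2 fun j => ?_
    simp [T, abs_of_pos hε]
  have hd : hausdorffDist (T '' B) B ≤ ε := by
    refine hausdorffDist_le_of_mem_dist hε.le ?_ fun β hβ =>
      ⟨T β, mem_image_of_mem T hβ, by rw [dist_comm]; exact hT β⟩
    rintro _ ⟨β, hβ, rfl⟩
    exact ⟨β, hβ, hT β⟩
  have h_strict : ν A ≤ ν (T '' B) := by
    refine hν_strong _ _ hA (hB.image T) hA' (hB'.image T) fun α hα i j => ?_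
    obtain ⟨β, hβ, hle⟩ := h α hα i j
    exact ⟨T β, mem_image_of_mem T hβ, by simp only [T]; linarith⟩
  have h_stable := hν_stable _ _ (hB.image T) hB (hB'.image T) hB'
  linarith [le_abs_self (ν (T '' B) - ν B)]

theorem finite_entries {n : ℕ} {A : Set (Fin n → Fin n → ℝ)} (hA : A.Finite) (i j : Fin n) :
    { t | ∃ α ∈ A, t = α i j }.Finite :=
  (hA.image fun α => α i j).subset fun _ ⟨α, hα, ht⟩ => ⟨α, hα, ht.symm⟩

theorem le_maxMat {n : ℕ} {A : Set (Fin n → Fin n → ℝ)} (hA : A.Finite)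
    {α : Fin n → Fin n → ℝ} (hα : α ∈ A) (i j : Fin n) : α i j ≤ maxMat A i j :=
  le_csSup (finite_entries hA i j).bddAbove ⟨α, hα, rfl⟩

theorem exists_maxMat_eq {n : ℕ} {A : Set (Fin n → Fin n → ℝ)} (hA : A.Finite)
    (hA' : A.Nonempty) (i j : Fin n) : ∃ α ∈ A, maxMat A i j = α i j :=
  let ⟨α, hα⟩ := hA'
  Set.Nonempty.csSup_mem (s := { t | ∃ α ∈ A, t = α i j }) ⟨α i j, α, hα, rfl⟩
    (finite_entries hA i j)

theorem finite_dists {X : Type} [MetricSpace X] [Finite X] (σ : Set X) :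
    { t | ∃ x ∈ σ, ∃ x' ∈ σ, t = dist x x' }.Finite :=
  (finite_range fun p : X × X => dist p.1 p.2).subset
    fun _ ⟨x, _, x', _, ht⟩ => ⟨(x, x'), ht.symm⟩

theorem exists_sdiam_eq {X : Type} [MetricSpace X] [Finite X] {σ : Set X}
    (hσ : σ.Nonempty) : ∃ x ∈ σ, ∃ y ∈ σ, sdiam σ = dist x y :=
  let ⟨x, hx⟩ := hσ
  Set.Nonempty.csSup_mem (s := { t | ∃ x ∈ σ, ∃ x' ∈ σ, t = dist x x' })
    ⟨dist x x, x, hx, x, hx, rfl⟩ (finite_dists σ)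

theorem finite_curvSet {X : Type} [MetricSpace X] [Finite X] (n : ℕ) (σ : Set X) :
    (curvSet X n σ).Finite :=
  (finite_range fun (x : Fin n → X) i j => dist (x i) (x j)).subset
    fun _ ⟨x, _, hx⟩ => ⟨x, hx.symm⟩

theorem dist_diagZero_le (n : ℕ) (r s : ℝ) : dist (diagZero n r) (diagZero n s) ≤ |r - s| := by
  refine (dist_pi_le_iff (abs_nonneg _)).2 fun i => (dist_pi_le_iff (abs_nonneg _)).2 fun j => ?_
  by_cases hij : i = j <;> simp [diagZero, hij, Real.dist_eq]

/-- Let `ν` be a strongly increasing, 1-stable `n`-valuation (`n ≥ 2`).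
Then (i) `ν A = ν {max A}` for every finite nonempty `A`; and (ii) the function
`f_ν(r) = ν {M(r)}` is 1-Lipschitz and `ν (K_n σ) = f_ν (diam σ)` for every finite
metric space `X` and nonempty `σ ⊆ X`. -/
theorem strongly_increasing_stable_valuation_is_rips (n : ℕ) (hn : 2 ≤ n)
    (ν : Set (Fin n → Fin n → ℝ) → ℝ)
    (hν_nonneg : ∀ A : Set (Fin n → Fin n → ℝ), A.Finite → A.Nonempty → 0 ≤ ν A)
    (hν_mono : ∀ A B : Set (Fin n → Fin n → ℝ), A.Finite → B.Finite →
      A.Nonempty → A ⊆ B → ν A ≤ ν B)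
    (hν_strong : ∀ A B : Set (Fin n → Fin n → ℝ), A.Finite → B.Finite →
      A.Nonempty → B.Nonempty →
      (∀ α ∈ A, ∀ i j : Fin n, ∃ β ∈ B, α i j < β i j) → ν A ≤ ν B)
    (hν_stable : ∀ A B : Set (Fin n → Fin n → ℝ), A.Finite → B.Finite →
      A.Nonempty → B.Nonempty → |ν A - ν B| ≤ hausdorffDist A B) :
    (∀ A : Set (Fin n → Fin n → ℝ), A.Finite → A.Nonempty →
      ν A = ν {maxMat A}) ∧
    (∀ r s : ℝ, |ν {diagZero n r} - ν {diagZero n s}| ≤ |r - s|) ∧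
    (∀ (X : Type) [MetricSpace X] [Fintype X] [Nonempty X] (σ : Set X),
      σ.Nonempty → ν (curvSet X n σ) = ν {diagZero n (sdiam σ)}) := by
  have le_of_le {A B : Set (Fin n → Fin n → ℝ)} :=
    le_of_forall_entry_le hν_strong hν_stable (A := A) (B := B)
  refine ⟨fun A hA hA' => ?_, fun r s => ?_, fun X _ _ _ σ hσ => ?_⟩
  · apply le_antisymm
    · exact le_of_le hA (finite_singleton _) hA' (singleton_nonempty _)
        fun α hα i j => ⟨_, rfl, le_maxMat hA hα i j⟩
    · refine le_of_le (finite_singleton _) hA (singleton_nonempty _) hA' ?_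
      rintro _ rfl i j
      obtain ⟨α, hα, h⟩ := exists_maxMat_eq hA hA' i j
      exact ⟨α, hα, h.le⟩
  · refine (hν_stable _ _ (finite_singleton _) (finite_singleton _) (singleton_nonempty _)
      (singleton_nonempty _)).trans ?_
    refine hausdorffDist_le_of_mem_dist (abs_nonneg _) ?_ ?_
    · rintro _ rfl
      exact ⟨_, rfl, dist_diagZero_le n r s⟩
    · rintro _ rfl
      exact ⟨_, rfl, by rw [dist_comm]; exact dist_diagZero_le n r s⟩
  · apply le_antisymm
    · refine le_of_le (finite_curvSet n σ) (finite_singleton _) (curvSet_nonempty n hσ)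
        (singleton_nonempty _) ?_
      rintro _ ⟨x, hx, rfl⟩ i j
      refine ⟨_, rfl, ?_⟩
      by_cases hij : i = j
      · simp [diagZero, hij]
      · simpa [diagZero, hij] using dist_le_sdiam (hx i) (hx j)
    · refine le_of_le (finite_singleton _) (finite_curvSet n σ) (singleton_nonempty _)
        (curvSet_nonempty n hσ) ?_
      rintro _ rfl i j
      obtain ⟨a, ha, b, hb, hab⟩ := exists_sdiam_eq hσ
      refine ⟨_, ⟨fun k => if k = i then a else b, fun k => ?_, rfl⟩, ?_⟩
      · dsimp only
        split_ifs <;> assumption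
      · by_cases hij : i = j
        · simp [diagZero, hij]
        · simp [diagZero, hij, Ne.symm hij, hab]
end
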